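/- Let (Δ,δ) be a building of type (W,S) where W satisfies the nested condition relative to u ∈ S, let G be a group acting isometrically on Δ, and fix a chamber C₀ ∈ Δ. With T_u := {s ∈ S : m_{su} = 2}, W_{T_u} the subgroup generated by T_u, and G₀ := {g ∈ G : δ(C₀, g•C₀) ∈ W_{T_u}}, the multiplier m_G^u is left G₀-invariant: for every g ∈ G₀ and every h ∈ G, m_G^u(gh) = m_G^u(h). -/

import Mathlib

open Pointwise
open scoped Classical

variable {B : Type*} {W : Type*} [Group W] {M : CoxeterMatrix B}

/-- The positive root `H_s^+` associated to the generator indexed by `i`: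
elements `g` with `l(sg) > l(g)`. -/
def Hp (cs : CoxeterSystem M W) (i : B) : Set W :=
  {g : W | cs.length g < cs.length (cs.simple i * g)}

/-- The negative root `H_s^-`: elements `g` with `l(sg) < l(g)`. -/
def Hm (cs : CoxeterSystem M W) (i : B) : Set W :=
  {g : W | cs.length (cs.simple i * g) < cs.length g}

/-- `g` satisfies one of the six cases of the nested condition relative to `s`. -/
def NestedAt (cs : CoxeterSystem M W) (i : B) (g : W) : Prop :=
  g • Hp cs i = Hp cs i ∨ g • Hp cs i = Hm cs i ∨
  g • Hp cs i ⊂ Hp cs i ∨ g • Hp cs i ⊂ Hm cs i ∨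
  g • Hm cs i ⊂ Hp cs i ∨ g • Hm cs i ⊂ Hm cs i

/-- `W` satisfies the nested condition relative to the generator indexed by `i`. -/
def Nested (cs : CoxeterSystem M W) (i : B) : Prop := ∀ g : W, NestedAt cs i g

/-- The stabilizer `Stab_{H_s^+}` of the positive root. -/
def StabHp (cs : CoxeterSystem M W) (i : B) : Set W :=
  {g : W | g • Hp cs i = Hp cs i}

/-- The multiplier `m_W^s`. -/
noncomputable def mWs (cs : CoxeterSystem M W) (i : B) (g : W) : ℤ :=
  if g ∈ Hp cs i then 1 else -1

/-- `(Δ, d)` is a building of type `(W,S)`: axioms (B1), (B2), (B3). -/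
def IsBuilding (cs : CoxeterSystem M W) (Δ : Type*) (d : Δ → Δ → W) : Prop :=
  Nonempty Δ ∧
  (∀ C D : Δ, d C D = 1 ↔ C = D) ∧
  (∀ (C D E : Δ) (i : B), d E C = cs.simple i →
    (d E D = cs.simple i * d C D ∨ d E D = d C D) ∧
    (cs.length (d C D) < cs.length (cs.simple i * d C D) → d E D = cs.simple i * d C D)) ∧
  (∀ (C D : Δ) (i : B), ∃ E : Δ, d E C = cs.simple i ∧ d E D = cs.simple i * d C D)

/-- `φ : W → Δ` is an isometry into the building. -/
def IsIsom {Δ : Type*} (d : Δ → Δ → W) (φ : W → Δ) : Prop :=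
  ∀ a b : W, d (φ a) (φ b) = a⁻¹ * b

/-- The parabolic subgroup `W_{T_u}` where `T_u = {s ∈ S : m_{su} = 2}`. -/
def WTu (cs : CoxeterSystem M W) (u : B) : Subgroup W :=
  Subgroup.closure (cs.simple '' {j : B | M j u = 2})

/-- The multiplier `m_G^u` for a group `G` acting on the building. -/
noncomputable def mG {G : Type*} [Group G] (cs : CoxeterSystem M W) {Δ : Type*}
    (d : Δ → Δ → W) [MulAction G Δ] (C₀ : Δ) (u : B) (g : G) : ℤ :=
  if cs.length (d C₀ (g • C₀)) < cs.length (cs.simple u * d C₀ (g • C₀)) then 1 else -1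

namespace CoxeterMatrix

/-- The entries `-2 cos (π / M i j)` of twice the canonical bilinear form. -/
noncomputable def cosEntry (M : CoxeterMatrix B) (i j : B) : ℝ :=
  -2 * Real.cos (Real.pi / M i j)

/-- The coroot of index `i` in the geometric representation. -/
noncomputable def geomCoroot (M : CoxeterMatrix B) (i : B) : Module.Dual ℝ (B →₀ ℝ) :=
  Finsupp.linearCombination ℝ (M.cosEntry i)

lemma geomCoroot_single (M : CoxeterMatrix B) (i j : B) :
    M.geomCoroot i (Finsupp.single j 1) = M.cosEntry i j := by
  simp [geomCoroot]

lemma geomCoroot_self (M : CoxeterMatrix B) (i : B) :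
    M.geomCoroot i (Finsupp.single i 1) = 2 := by
  simp [geomCoroot_single, cosEntry]

/-- The simple reflections of the geometric representation. -/
noncomputable def geomReflection (M : CoxeterMatrix B) (i : B) : (B →₀ ℝ) ≃ₗ[ℝ] (B →₀ ℝ) :=
  Module.reflection (M.geomCoroot_self i)

lemma sin_two_pi_div_ne_zero {m : ℕ} (hm : 3 ≤ m) : Real.sin (2 * Real.pi / m) ≠ 0 := by
  have hm' : (3 : ℝ) ≤ m := by exact_mod_cast hm
  refine (Real.sin_pos_of_pos_of_lt_pi (by positivity) ?_).ne'
  rw [div_lt_iff₀ (by linarith)]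
  nlinarith [Real.pi_pos]

lemma chebyshev_S_eval_eq_zero {m k : ℕ} (hk : m = 2 * k) (hm : 3 ≤ m) :
    (Polynomial.Chebyshev.S ℝ (k - 1)).eval (2 * Real.cos (2 * Real.pi / m)) = 0 := by
  refine (mul_eq_zero.mp ?_).resolve_right (sin_two_pi_div_ne_zero hm)
  rw [Polynomial.Chebyshev.S_two_mul_real_cos]
  have hk0 : (k : ℝ) ≠ 0 := by exact_mod_cast (by omega : k ≠ 0)
  convert Real.sin_pi using 2
  subst hk
  push_cast
  field_simp
  ring

lemma chebyshev_S_eval_add_eq_zero {m k : ℕ} (hk : m = 2 * k + 1) (hm : 3 ≤ m) :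
    (Polynomial.Chebyshev.S ℝ k).eval (2 * Real.cos (2 * Real.pi / m)) +
      (Polynomial.Chebyshev.S ℝ (k - 1)).eval (2 * Real.cos (2 * Real.pi / m)) = 0 := by
  refine (mul_eq_zero.mp ?_).resolve_right (sin_two_pi_div_ne_zero hm)
  rw [add_mul, Polynomial.Chebyshev.S_two_mul_real_cos, Polynomial.Chebyshev.S_two_mul_real_cos]
  have hk0 : (2 * k + 1 : ℝ) ≠ 0 := by positivity
  have h : (((k : ℤ) : ℝ) + 1) * (2 * Real.pi / m) =
      2 * Real.pi - ((((k : ℤ) - 1 : ℤ) : ℝ) + 1) * (2 * Real.pi / m) := by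
    subst hk
    push_cast
    field_simp
    ring
  rw [h, Real.sin_two_pi_sub]
  ring

lemma isLiftable_geomReflection (M : CoxeterMatrix B) : M.IsLiftable M.geomReflection := by
  intro i j
  rcases eq_or_ne i j with rfl | hij
  · rw [M.diagonal, pow_one]
    refine LinearEquiv.ext fun v ↦ ?_
    exact Module.involutive_reflection (M.geomCoroot_self i) v
  have h_off := M.off_diagonal i j hij
  have h_symm : M.cosEntry j i = M.cosEntry i j := by rw [cosEntry, M.symmetric, cosEntry]
  rcases (by omega : M i j = 0 ∨ M i j = 2 ∨ 3 ≤ M i j) with h | h | h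
  · rw [h, pow_zero]
  · have h0 : M.cosEntry i j = 0 := by simp [cosEntry, h]
    rw [h, pow_two]
    refine LinearEquiv.ext fun v ↦ ?_
    change _ = v
    simp only [LinearEquiv.mul_apply, geomReflection, Module.reflection_apply, map_sub, map_smul,
      geomCoroot_self, geomCoroot_single, h_symm, h0]
    module
  · have ht : 2 * Real.cos (2 * Real.pi / M i j) = M.geomCoroot i (Finsupp.single j 1) *
        M.geomCoroot j (Finsupp.single i 1) - 2 := by
      rw [geomCoroot_single, geomCoroot_single, h_symm, cosEntry, mul_div_assoc, Real.cos_two_mul]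
      ring
    refine LinearEquiv.ext fun v ↦ ?_
    rw [geomReflection, geomReflection,
      Module.reflection_mul_reflection_pow_apply _ _ _ _ _ ht]
    obtain ⟨k, hk | hk⟩ := Nat.even_or_odd' (M i j)
    · have e1 : ((M i j : ℤ) - 2) / 2 = k - 1 := by omega
      have e2 : ((M i j : ℤ) - 1) / 2 = k - 1 := by omega
      rw [e1, e2, chebyshev_S_eval_eq_zero hk h]
      simp
    · have e1 : ((M i j : ℤ) - 2) / 2 = k - 1 := by omega
      have e2 : ((M i j : ℤ) - 1) / 2 = k := by omega
      have e3 : ((M i j : ℤ) - 3) / 2 = k - 1 := by omega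
      have e4 : (M i j : ℤ) / 2 = k := by omega
      rw [e1, e2, e3, e4, chebyshev_S_eval_add_eq_zero hk h]
      simp

lemma geomReflection_injective (M : CoxeterMatrix B) : Function.Injective M.geomReflection := by
  intro i j h
  by_contra hij
  have h1 := DFunLike.congr_fun (LinearEquiv.congr_fun h (Finsupp.single i 1)) i
  simp [geomReflection, Module.reflection_apply, Ne.symm hij] at h1
  norm_num at h1

end CoxeterMatrix

namespace CoxeterSystem

lemma simple_injective (cs : CoxeterSystem M W) : Function.Injective cs.simple := by
  intro i j h
  apply M.geomReflection_injective
  rw [← cs.lift_apply_simple M.isLiftable_geomReflection i, h, cs.lift_apply_simple]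

lemma length_simple_mul_simple (cs : CoxeterSystem M W) {i j : B} (hij : i ≠ j) :
    cs.length (cs.simple i * cs.simple j) = 2 := by
  rcases cs.length_simple_mul (cs.simple j) i with h | h
  · rw [h, cs.length_simple]
  · rw [cs.length_simple] at h
    have h1 : cs.simple i * cs.simple j = 1 := cs.length_eq_zero_iff.mp (by omega)
    refine absurd (cs.simple_injective ?_) hij
    rw [mul_eq_one_iff_eq_inv.mp h1, cs.inv_simple]

lemma commute_simple (cs : CoxeterSystem M W) {i j : B} (h : M i j = 2) :
    Commute (cs.simple i) (cs.simple j) := by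
  have h1 := cs.simple_mul_simple_pow i j
  rw [h, pow_two] at h1
  have h2 := mul_eq_one_iff_eq_inv.mp h1
  rwa [mul_inv_rev, cs.inv_simple, cs.inv_simple] at h2

end CoxeterSystem

lemma compl_Hp (cs : CoxeterSystem M W) (u : B) : (Hp cs u)ᶜ = Hm cs u := by
  ext g
  have := cs.length_simple_mul_ne g u
  simp only [Hp, Hm, Set.mem_compl_iff, Set.mem_ofPred_eq]
  omega

/-- An involution cannot move a set to a proper subset of itself. -/
lemma not_smul_ssubset_self_of_mul_self {G α : Type*} [Group G] [MulAction G α] {s : G}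
    (hs : s * s = 1) (A : Set α) : ¬ s • A ⊂ A := by
  intro h
  have h1 := Set.smul_set_mono (a := s) h.1
  rw [smul_smul, hs, one_smul] at h1
  exact h.2 h1

/-- Under the nested condition, a simple reflection commuting with `u` and distinct from it
stabilizes the positive root of `u`. -/
lemma simple_smul_Hp (cs : CoxeterSystem M W) {u j : B} (hnest : Nested cs u) (hj : M j u = 2) :
    cs.simple j • Hp cs u = Hp cs u := by
  have hne : j ≠ u := by
    rintro rfl
    simp at hj
  have hlen := cs.length_simple_mul_simple hne.symm
  have h1 : (1 : W) ∈ Hp cs u := by simp [Hp]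
  have hju : cs.simple j ∈ Hp cs u := by simp [Hp, hlen]
  have hju' : cs.simple j ∉ Hm cs u := by simp [Hm, hlen]
  have hjmem : cs.simple j ∈ cs.simple j • Hp cs u := by
    simpa using Set.smul_mem_smul_set (a := cs.simple j) h1
  have hu : cs.simple u ∈ Hm cs u := by simp [Hm]
  have hss := cs.simple_mul_simple_self j
  rcases hnest (cs.simple j) with h | h | h | h | h | h
  · exact h
  · exact absurd (h ▸ hjmem) hju'
  · exact absurd h (not_smul_ssubset_self_of_mul_self hss _)
  · exact absurd (h.1 hjmem) hju'
  · have h2 := h.1 (Set.smul_mem_smul_set (a := cs.simple j) hu)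
    rw [← compl_Hp] at hu
    simp [Hp, smul_eq_mul, (cs.commute_simple hj).eq, hlen] at h2
  · exact absurd h (not_smul_ssubset_self_of_mul_self hss _)

lemma smul_Hp_of_mem_WTu (cs : CoxeterSystem M W) {u : B} (hnest : Nested cs u) {v : W}
    (hv : v ∈ WTu cs u) : v • Hp cs u = Hp cs u := by
  have hle : WTu cs u ≤ MulAction.stabilizer W (Hp cs u) := by
    rw [WTu, Subgroup.closure_le]
    rintro _ ⟨j, hj, rfl⟩
    exact simple_smul_Hp cs hnest hj
  exact hle hv

/-- Replacing the first chamber by one at distance in the subgroup generated by `T` changes the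
distance to `D` by left multiplication by an element of this subgroup. -/
lemma IsBuilding.exists_mul_of_mem_closure {cs : CoxeterSystem M W} {Δ : Type*} {d : Δ → Δ → W}
    (hb : IsBuilding cs Δ d) (T : Set B) {C E : Δ} (D : Δ)
    (h : d E C ∈ Subgroup.closure (cs.simple '' T)) :
    ∃ v ∈ Subgroup.closure (cs.simple '' T), d E D = v * d C D := by
  obtain ⟨-, hB1, hB2, hB3⟩ := hb
  have key : ∀ i ∈ T, ∀ w : W,
      (∀ E, d E C = w → ∃ v ∈ Subgroup.closure (cs.simple '' T), d E D = v * d C D) →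
      ∀ E, d E C = cs.simple i * w →
        ∃ v ∈ Subgroup.closure (cs.simple '' T), d E D = v * d C D := by
    intro i hi w ih E hE
    obtain ⟨E', hE', hE'C⟩ := hB3 E C i
    obtain ⟨v, hv, hvD⟩ := ih E' (by rw [hE'C, hE, cs.simple_mul_simple_cancel_left])
    rcases (hB2 E D E' i hE').1 with h1 | h1
    · refine ⟨cs.simple i * v, mul_mem (Subgroup.subset_closure ⟨i, hi, rfl⟩) hv, ?_⟩
      rw [mul_assoc, ← hvD, h1, cs.simple_mul_simple_cancel_left]
    · exact ⟨v, hv, h1 ▸ hvD⟩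
  suffices ∀ w ∈ Subgroup.closure (cs.simple '' T), ∀ E, d E C = w →
      ∃ v ∈ Subgroup.closure (cs.simple '' T), d E D = v * d C D from this _ h E rfl
  intro w hw
  induction hw using Subgroup.closure_induction_left with
  | one =>
    intro E hE
    rw [hB1] at hE
    exact ⟨1, one_mem _, by rw [hE, one_mul]⟩
  | mul_left x hx w _ ih =>
    obtain ⟨i, hi, rfl⟩ := hx
    exact key i hi w ih
  | inv_mul_cancel x hx w _ ih =>
    obtain ⟨i, hi, rfl⟩ := hx
    rw [cs.inv_simple]
    exact key i hi w ih

/-- The multiplier `m_G^u` is left `G₀`-invariant. -/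
theorem mG_left_G0_invariant {G : Type*} [Group G] (cs : CoxeterSystem M W)
    (u : B) (hnest : Nested cs u) {Δ : Type*} (d : Δ → Δ → W) (hb : IsBuilding cs Δ d)
    [MulAction G Δ] (hact : ∀ (g : G) (C D : Δ), d (g • C) (g • D) = d C D)
    (C₀ : Δ) :
    ∀ g ∈ {g : G | d C₀ (g • C₀) ∈ WTu cs u}, ∀ h : G,
      mG cs d C₀ u (g * h) = mG cs d C₀ u h := by
  intro g hg h
  obtain ⟨v, hv, hvD⟩ := hb.exists_mul_of_mem_closure _ ((g * h) • C₀) hg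
  rw [mul_smul, hact] at hvD
  have hiff : v * d C₀ (h • C₀) ∈ Hp cs u ↔ d C₀ (h • C₀) ∈ Hp cs u := by
    conv_lhs => rw [← smul_Hp_of_mem_WTu cs hnest hv]
    exact Set.smul_mem_smul_set_iff
  simp only [Hp, Set.mem_ofPred_eq] at hiff
  simp only [mG, mul_smul, hvD, hiff]
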